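/- arXiv:1201.0941 — 2 statements merged into one kernel-verified Lean document; each statement's English description precedes it below -/
import Mathlib

section
/- For every integer n ≥ 2, λ(W_n) > 1/10, where W_n = {α ∈ (0,1) irrational : Σ_{i=1}^{n} a_i(α) < 10·n·log n}. -/
open MeasureTheory Filter Set
open scoped ENNReal

noncomputable def gaussMap (x : ℝ) : ℝ := Int.fract (1 / x)

/-- The `n`-th continued fraction partial quotient of `α` (for `n ≥ 1`). -/
noncomputable def cfA (α : ℝ) (n : ℕ) : ℕ := ⌊1 / (gaussMap^[n - 1] α)⌋₊

/-- `W n` : the set of irrationals `α ∈ (0,1)` with `Σ_{i=1}^n a_i(α) < 10 n log n`. -/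
def Wset (n : ℕ) : Set ℝ :=
  {α | α ∈ Set.Ioo (0:ℝ) 1 ∧ Irrational α ∧
    (∑ i ∈ Finset.Icc 1 n, (cfA α i : ℝ)) < 10 * n * Real.log n}

/-- The (unnormalised) Gauss measure. -/
noncomputable def gaussNu : Measure ℝ :=
  (volume.restrict (Ioc (0:ℝ) 1)).withDensity (fun x => ENNReal.ofReal (1 / (1 + x)))

lemma gaussNu_apply {s : Set ℝ} (hs : MeasurableSet s) :
    gaussNu s = ∫⁻ x in s ∩ Ioc (0:ℝ) 1, ENNReal.ofReal (1 / (1 + x)) := by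
  rw [gaussNu, withDensity_apply _ hs, Measure.restrict_restrict hs]

lemma gaussNu_le : gaussNu ≤ volume := by
  rw [Measure.le_iff]
  intro s hs
  rw [gaussNu_apply hs]
  calc ∫⁻ x in s ∩ Ioc (0:ℝ) 1, ENNReal.ofReal (1 / (1 + x))
      ≤ ∫⁻ x in s ∩ Ioc (0:ℝ) 1, 1 := by
        refine setLIntegral_mono' (hs.inter measurableSet_Ioc) ?_
        rintro x ⟨_, hx0, hx1⟩
        rw [← ENNReal.ofReal_one]
        apply ENNReal.ofReal_le_ofReal
        rw [div_le_one (by linarith)]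
        linarith
    _ ≤ volume s := by
        simp only [setLIntegral_one]
        exact measure_mono inter_subset_left

lemma lint_Ioc {a b : ℝ} (ha : 0 ≤ a) (hab : a ≤ b) :
    ∫⁻ x in Ioc a b, ENNReal.ofReal (1 / (1 + x))
      = ENNReal.ofReal (Real.log (1 + b) - Real.log (1 + a)) := by
  have hcont : ContinuousOn (fun x : ℝ => 1 / (1 + x)) (uIcc a b) := by
    apply ContinuousOn.div continuousOn_const (by fun_prop)
    intro x hx
    rw [uIcc_of_le hab] at hx
    have := hx.1
    linarith
  have hint := hcont.intervalIntegrable (μ := volume)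
  rw [← ofReal_integral_eq_lintegral_ofReal]
  · rw [← intervalIntegral.integral_of_le hab]
    congr 1
    refine intervalIntegral.integral_eq_sub_of_hasDerivAt (f := fun x => Real.log (1 + x)) ?_ hint
    intro x hx
    rw [uIcc_of_le hab] at hx
    have h0 := hx.1
    exact ((hasDerivAt_id x).const_add 1).log (by simp; linarith)
  · exact (intervalIntegrable_iff_integrableOn_Ioc_of_le hab).1 hint
  · filter_upwards [ae_restrict_mem measurableSet_Ioc] with x hx
    have := hx.1
    simp only [Pi.zero_apply]
    apply div_nonneg <;> linarith

lemma gaussNu_of_eq {s : Set ℝ} (hs : MeasurableSet s) {a b : ℝ} (ha : 0 ≤ a) (hab : a ≤ b)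
    (h : s ∩ Ioc (0:ℝ) 1 = Ioc a b) :
    gaussNu s = ENNReal.ofReal (Real.log (1 + b) - Real.log (1 + a)) := by
  rw [gaussNu_apply hs, h, lint_Ioc ha hab]

lemma gaussNu_univ : gaussNu univ = ENNReal.ofReal (Real.log 2) := by
  rw [gaussNu_of_eq MeasurableSet.univ (a := 0) (b := 1) le_rfl zero_le_one (by simp)]
  norm_num

instance : IsFiniteMeasure gaussNu := ⟨by rw [gaussNu_univ]; exact ENNReal.ofReal_lt_top⟩

lemma gaussNu_Icc {a b : ℝ} (ha : 0 < a) (hab : a ≤ b) (hb : b ≤ 1) :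
    gaussNu (Icc a b) = ENNReal.ofReal (Real.log (1 + b) - Real.log (1 + a)) := by
  rw [gaussNu_apply measurableSet_Icc, ← lint_Ioc ha.le hab]
  have : Icc a b ∩ Ioc 0 1 = Icc a b :=
    inter_eq_left.2 fun x hx => ⟨ha.trans_le hx.1, hx.2.trans hb⟩
  rw [this]
  exact setLIntegral_congr Ioc_ae_eq_Icc.symm

lemma measurable_gaussMap : Measurable gaussMap :=
  measurable_fract.comp (measurable_const.div measurable_id)

lemma gaussNu_compl : gaussNu (Ioc (0:ℝ) 1)ᶜ = 0 := by
  rw [gaussNu_apply measurableSet_Ioc.compl]; simp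

lemma pre_eq {t : ℝ} (h0 : 0 ≤ t) (h1 : t < 1) :
    gaussMap ⁻¹' (Iic t) ∩ Ioc (0:ℝ) 1
      = ⋃ j : ℕ, Icc (1 / ((j:ℝ) + 1 + t)) (1 / ((j:ℝ) + 1)) := by
  ext x
  simp only [mem_inter_iff, mem_preimage, mem_Iic, mem_Ioc, mem_iUnion, mem_Icc, gaussMap]
  constructor
  · rintro ⟨hf, hx0, hx1⟩
    have hx : 1 ≤ 1 / x := by rw [le_div_iff₀ hx0]; linarith
    have hfl : 1 ≤ ⌊1 / x⌋ := Int.le_floor.2 (by simpa using hx)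
    obtain ⟨j, hj⟩ := Int.eq_ofNat_of_zero_le (sub_nonneg.2 hfl)
    have hj' : ((⌊1 / x⌋ : ℤ) : ℝ) = (j:ℝ) + 1 := by
      have : ⌊1 / x⌋ = (j:ℤ) + 1 := by linarith
      rw [this]; push_cast; ring
    have h2 := Int.floor_add_fract (1 / x)
    have h3 := Int.fract_nonneg (1 / x)
    refine ⟨j, ?_, ?_⟩
    · rw [one_div_le (by positivity) hx0]; linarith
    · rw [le_one_div hx0 (by positivity)]; linarith
  · rintro ⟨j, ha, hb⟩
    have hx0 : 0 < x := lt_of_lt_of_le (by positivity) ha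
    rw [one_div_le (by positivity) hx0] at ha
    rw [le_one_div hx0 (by positivity)] at hb
    have hfl : ⌊1 / x⌋ = (j:ℤ) + 1 := by
      rw [Int.floor_eq_iff]; push_cast; constructor <;> linarith
    refine ⟨?_, hx0, ?_⟩
    · rw [Int.fract, hfl]; push_cast; linarith
    · have : 1 ≤ 1 / x := by
        have : (0:ℝ) ≤ j := j.cast_nonneg
        linarith
      rw [le_div_iff₀ hx0] at this
      linarith

lemma tele {t : ℝ} (h0 : 0 ≤ t) :
    ∑' j : ℕ, ENNReal.ofReal
      (Real.log (1 + 1 / ((j:ℝ) + 1)) - Real.log (1 + 1 / ((j:ℝ) + 1 + t)))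
      = ENNReal.ofReal (Real.log (1 + t)) := by
  set g : ℕ → ℝ := fun j => Real.log (((j:ℝ) + 1) / ((j:ℝ) + 1 + t)) with hg
  have hterm : ∀ j : ℕ, Real.log (1 + 1 / ((j:ℝ) + 1)) - Real.log (1 + 1 / ((j:ℝ) + 1 + t))
      = g (j + 1) - g j := by
    intro j
    have hj : (0:ℝ) ≤ j := j.cast_nonneg
    have e1 : 1 + 1 / ((j:ℝ) + 1) = ((j:ℝ) + 1 + 1) / ((j:ℝ) + 1) := by field_simp
    have e2 : 1 + 1 / ((j:ℝ) + 1 + t) = ((j:ℝ) + 1 + 1 + t) / ((j:ℝ) + 1 + t) := by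
      field_simp; ring
    simp only [hg]
    push_cast
    rw [e1, e2, Real.log_div, Real.log_div, Real.log_div, Real.log_div] <;> first | positivity | ring
  have hnn : ∀ j : ℕ, 0 ≤ g (j + 1) - g j := by
    intro j
    rw [← hterm, sub_nonneg]
    apply Real.log_le_log (by positivity)
    have : 1 / ((j:ℝ) + 1 + t) ≤ 1 / ((j:ℝ) + 1) :=
      one_div_le_one_div_of_le (by positivity) (by linarith)
    linarith
  have hlim : Tendsto g atTop (nhds 0) := by
    have h1 : Tendsto (fun j : ℕ => ((j:ℝ) + 1) / ((j:ℝ) + 1 + t)) atTop (nhds 1) := by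
      have h2 : Tendsto (fun j : ℕ => 1 - t / ((j:ℝ) + 1 + t)) atTop (nhds (1 - 0)) := by
        refine tendsto_const_nhds.sub (tendsto_const_nhds.div_atTop ?_)
        exact tendsto_atTop_add_const_right _ _
          (tendsto_atTop_add_const_right _ _ tendsto_natCast_atTop_atTop)
      rw [sub_zero] at h2
      refine h2.congr fun j => ?_
      have : (j:ℝ) + 1 + t ≠ 0 := by positivity
      field_simp; ring
    have := (Real.continuousAt_log one_ne_zero).tendsto.comp h1
    rwa [Real.log_one] at this
  have hg0 : g 0 = - Real.log (1 + t) := by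
    simp [hg]
  have hsum : HasSum (fun j => g (j + 1) - g j) (Real.log (1 + t)) := by
    rw [hasSum_iff_tendsto_nat_of_nonneg hnn]
    simp_rw [Finset.sum_range_sub]
    rw [hg0]
    simpa using hlim.sub_const (- Real.log (1 + t))
  simp_rw [hterm]
  rw [← ENNReal.ofReal_tsum_of_nonneg hnn hsum.summable, hsum.tsum_eq]

lemma gaussNu_pre (t : ℝ) : gaussNu (gaussMap ⁻¹' (Iic t)) = gaussNu (Iic t) := by
  have hm := measurable_gaussMap (measurableSet_Iic (a := t))
  rcases lt_or_ge t 0 with h | h0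
  · have e1 : gaussMap ⁻¹' (Iic t) = ∅ := by
      ext x
      simp only [mem_preimage, mem_Iic, mem_empty_iff_false, iff_false, not_le, gaussMap]
      exact h.trans_le (Int.fract_nonneg _)
    have e2 : Iic t ∩ Ioc (0:ℝ) 1 = ∅ := by
      ext x; simp only [mem_inter_iff, mem_Iic, mem_Ioc, mem_empty_iff_false, iff_false]
      rintro ⟨a, b, c⟩; linarith
    rw [e1, gaussNu_apply measurableSet_Iic, e2]; simp
  rcases lt_or_ge t 1 with h1 | h1
  · have hI : gaussNu (Iic t) = ENNReal.ofReal (Real.log (1 + t)) := by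
      rw [gaussNu_of_eq measurableSet_Iic (a := 0) (b := t) le_rfl h0]
      · simp
      · ext x; simp only [mem_inter_iff, mem_Iic, mem_Ioc]
        constructor
        · rintro ⟨a, b, c⟩; exact ⟨b, a⟩
        · rintro ⟨a, b⟩; exact ⟨b, a, by linarith⟩
    have hA : gaussNu (gaussMap ⁻¹' (Iic t)) = gaussNu (gaussMap ⁻¹' (Iic t) ∩ Ioc (0:ℝ) 1) := by
      rw [gaussNu_apply hm, gaussNu_apply (hm.inter measurableSet_Ioc), inter_assoc, inter_self]
    rw [hI, hA, pre_eq h0 h1, measure_iUnion _ (fun _ => measurableSet_Icc), ← tele h0]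
    · congr 1; ext j
      have hj : (0:ℝ) ≤ j := j.cast_nonneg
      rw [gaussNu_Icc (by positivity)]
      · apply one_div_le_one_div_of_le (by positivity); linarith
      · rw [div_le_one (by positivity)]; linarith
    · intro i j hij
      apply Set.disjoint_left.2
      rintro x ⟨ha, hb⟩ ⟨ha', hb'⟩
      have hx0 : 0 < x := lt_of_lt_of_le (by positivity) ha
      rw [one_div_le (by positivity) hx0] at ha ha'
      rw [le_one_div hx0 (by positivity)] at hb hb'
      apply hij
      have h3 : (i:ℝ) < j + 1 := by linarith
      have h4 : (j:ℝ) < i + 1 := by linarith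
      have h5 : i < j + 1 := by exact_mod_cast h3
      have h6 : j < i + 1 := by exact_mod_cast h4
      omega
  · have e1 : gaussMap ⁻¹' (Iic t) = univ := by
      ext x
      simp only [mem_preimage, mem_Iic, mem_univ, iff_true, gaussMap]
      exact (Int.fract_lt_one _).le.trans h1
    have e2 : Iic t ∩ Ioc (0:ℝ) 1 = univ ∩ Ioc 0 1 := by
      ext x; simp only [mem_inter_iff, mem_Iic, mem_Ioc, mem_univ, true_and]
      constructor
      · rintro ⟨a, b⟩; exact b
      · rintro ⟨a, b⟩; exact ⟨by linarith, a, b⟩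
    rw [e1, gaussNu_apply measurableSet_Iic, e2, gaussNu_apply MeasurableSet.univ]

lemma mp_gauss : MeasurePreserving gaussMap gaussNu gaussNu := by
  refine ⟨measurable_gaussMap, ?_⟩
  haveI : IsFiniteMeasure (gaussNu.map gaussMap) := Measure.isFiniteMeasure_map _ _
  apply Measure.ext_of_Iic
  intro t
  rw [Measure.map_apply measurable_gaussMap measurableSet_Iic, gaussNu_pre]

lemma measurable_cfA (i : ℕ) : Measurable (fun x => cfA x i) := by
  unfold cfA
  exact Nat.measurable_floor.comp
    (measurable_const.div (measurable_gaussMap.iterate (i - 1)))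

lemma meas_ge (i k : ℕ) : MeasurableSet {x | k ≤ cfA x i} :=
  measurableSet_le measurable_const (measurable_cfA i)

lemma nu_cfA_ge (i k : ℕ) (hk : 1 ≤ k) :
    gaussNu {x | k ≤ cfA x i} = ENNReal.ofReal (Real.log (k + 1) - Real.log k) := by
  have hk' : (1:ℝ) ≤ k := by exact_mod_cast hk
  have hb : MeasurableSet {x : ℝ | k ≤ ⌊1 / x⌋₊} :=
    measurableSet_le measurable_const
      (Nat.measurable_floor.comp (measurable_const.div measurable_id))
  have h := (mp_gauss.iterate (i - 1)).measure_preimage hb.nullMeasurableSet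
  have e : gaussMap^[i-1] ⁻¹' {x : ℝ | k ≤ ⌊1 / x⌋₊} = {x | k ≤ cfA x i} := rfl
  rw [e] at h
  rw [h, gaussNu_of_eq hb (a := 0) (b := 1 / k) le_rfl (by positivity)]
  · have : 1 + 1 / (k:ℝ) = (k + 1) / k := by field_simp
    rw [this, Real.log_div (by positivity) (by positivity)]
    simp
  · ext x
    simp only [mem_inter_iff, mem_setOf_eq, mem_Ioc]
    rw [Nat.le_floor_iff' (by omega)]
    constructor
    · rintro ⟨a, b, c⟩
      exact ⟨b, by rwa [le_one_div b (by positivity)]⟩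
    · rintro ⟨a, b⟩
      refine ⟨by rwa [le_one_div (by positivity) a], a, b.trans ?_⟩
      rw [div_le_one (by positivity)]; exact hk'

/-- truncated sum -/
noncomputable def trF (n N : ℕ) (x : ℝ) : ℝ≥0∞ :=
  ∑ i ∈ Finset.Icc 1 n, ∑ k ∈ Finset.range N, {x | k + 1 ≤ cfA x i}.indicator 1 x

lemma lint_trF (n N : ℕ) :
    ∫⁻ x, trF n N x ∂gaussNu = ENNReal.ofReal (n * Real.log (N + 1)) := by
  unfold trF
  have hm : ∀ i k : ℕ, Measurable ({x | k + 1 ≤ cfA x i}.indicator (1 : ℝ → ℝ≥0∞)) :=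
    fun i k => measurable_one.indicator (meas_ge i (k+1))
  rw [lintegral_finsetSum _ (fun i _ => Finset.measurable_fun_sum _ fun k _ => hm i k)]
  have : ∀ i, ∫⁻ x, ∑ k ∈ Finset.range N, {x | k + 1 ≤ cfA x i}.indicator 1 x ∂gaussNu
      = ENNReal.ofReal (Real.log (N + 1)) := by
    intro i
    rw [lintegral_finsetSum _ (fun k _ => hm i k)]
    simp_rw [lintegral_indicator_one (meas_ge i _), nu_cfA_ge i _ (Nat.le_add_left 1 _)]
    rw [← ENNReal.ofReal_sum_of_nonneg]
    · congr 1
      have := Finset.sum_range_sub (fun k : ℕ => Real.log ((k:ℝ) + 1)) N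
      simpa using this
    · intro k _
      push_cast
      rw [sub_nonneg]
      exact Real.log_le_log (by positivity) (by linarith)
  simp_rw [this]
  rw [Finset.sum_const, Nat.card_Icc, Nat.add_sub_cancel, nsmul_eq_mul,
    ENNReal.ofReal_mul (by positivity), ENNReal.ofReal_natCast]

lemma inner_eq {N a : ℕ} (h : a ≤ N) :
    ∑ k ∈ Finset.range N, (if k + 1 ≤ a then (1:ℝ≥0∞) else 0) = a := by
  rw [Finset.sum_ite, Finset.sum_const_zero, add_zero, Finset.sum_const, nsmul_eq_mul, mul_one]
  have : Finset.filter (fun k => k + 1 ≤ a) (Finset.range N) = Finset.range a := by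
    ext k; simp only [Finset.mem_filter, Finset.mem_range]; omega
  rw [this, Finset.card_range]

lemma trF_eq {n N : ℕ} {x : ℝ} (h : ∀ i ∈ Finset.Icc 1 n, cfA x i ≤ N) :
    trF n N x = ENNReal.ofReal (∑ i ∈ Finset.Icc 1 n, (cfA x i : ℝ)) := by
  unfold trF
  rw [ENNReal.ofReal_sum_of_nonneg (fun _ _ => Nat.cast_nonneg _)]
  refine Finset.sum_congr rfl fun i hi => ?_
  rw [ENNReal.ofReal_natCast, ← inner_eq (h i hi)]
  refine Finset.sum_congr rfl fun k _ => ?_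
  simp [Set.indicator_apply]

theorem stmt10 (n : ℕ) (hn : 2 ≤ n) : (1 : ℝ≥0∞) / 10 < volume (Wset n) := by
  have hn' : (2:ℝ) ≤ n := by exact_mod_cast hn
  have hlog : 0 < Real.log n := Real.log_pos (by linarith)
  set c : ℝ := 10 * n * Real.log n with hc
  have hc0 : 0 < c := by positivity
  set N := 7 * n with hN
  -- the two bad sets
  set E1 : Set ℝ := {x | ENNReal.ofReal c ≤ trF n N x} with hE1
  set E2 : Set ℝ := ⋃ i ∈ Finset.Icc 1 n, {x | N + 1 ≤ cfA x i} with hE2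
  have hsub : (univ : Set ℝ) ⊆
      (((Wset n ∪ E1) ∪ E2) ∪ (Ioc (0:ℝ) 1)ᶜ) ∪ range ((↑) : ℚ → ℝ) := by
    intro x _
    by_cases hq : x ∈ range ((↑) : ℚ → ℝ)
    · exact Or.inr hq
    left
    by_cases hx : x ∈ Ioc (0:ℝ) 1
    swap
    · exact Or.inr hx
    left
    by_cases h2 : x ∈ E2
    · exact Or.inr h2
    left
    have hle : ∀ i ∈ Finset.Icc 1 n, cfA x i ≤ N := by
      intro i hi
      by_contra hcon
      exact h2 (mem_biUnion hi (by simp only [mem_setOf_eq]; omega))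
    by_cases h1 : x ∈ E1
    · exact Or.inr h1
    left
    have hx1 : x ≠ 1 := by
      rintro rfl
      exact hq ⟨1, by simp⟩
    refine ⟨⟨hx.1, lt_of_le_of_ne hx.2 hx1⟩, hq, ?_⟩
    by_contra hcon
    apply h1
    simp only [hE1, mem_setOf_eq]
    rw [trF_eq hle]
    exact ENNReal.ofReal_le_ofReal (not_lt.1 hcon)
  have hQ : gaussNu (range ((↑) : ℚ → ℝ)) = 0 := by
    refine le_antisymm ?_ zero_le
    refine (Measure.le_iff'.1 gaussNu_le _).trans ?_
    rw [(countable_range _).measure_zero]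
  have hb1 : gaussNu E1 ≤ ENNReal.ofReal (2 / 5) := by
    have hm := meas_ge_le_lintegral_div (μ := gaussNu) (f := trF n N)
      (Measurable.aemeasurable (by
        unfold trF
        exact Finset.measurable_fun_sum _ fun i _ => Finset.measurable_fun_sum _ fun k _ =>
          measurable_one.indicator (meas_ge i (k+1))))
      (ε := ENNReal.ofReal c) (by simpa using hc0) ENNReal.ofReal_ne_top
    refine hm.trans ?_
    rw [lint_trF, ← ENNReal.ofReal_div_of_pos hc0]
    apply ENNReal.ofReal_le_ofReal
    rw [div_le_iff₀ hc0, hc]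
    have h3 : Real.log ((N:ℝ) + 1) ≤ 4 * Real.log n := by
      have : (4:ℝ) * Real.log n = Real.log ((n:ℝ) ^ 4) := by rw [Real.log_pow]; norm_num
      rw [this]
      apply Real.log_le_log (by positivity)
      rw [hN]; push_cast
      have : (8:ℝ) ≤ (n:ℝ)^3 := by
        calc (8:ℝ) = 2 ^ 3 := by norm_num
          _ ≤ (n:ℝ)^3 := by gcongr
      nlinarith
    nlinarith
  have hb2 : gaussNu E2 ≤ ENNReal.ofReal (1 / 7) := by
    refine (measure_biUnion_finset_le _ _).trans ?_
    simp_rw [nu_cfA_ge _ (N + 1) (Nat.le_add_left 1 _)]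
    rw [Finset.sum_const, Nat.card_Icc, Nat.add_sub_cancel, nsmul_eq_mul,
      ← ENNReal.ofReal_natCast, ← ENNReal.ofReal_mul (by positivity)]
    apply ENNReal.ofReal_le_ofReal
    have hN0 : (0:ℝ) < ((N + 1 : ℕ) : ℝ) := by positivity
    rw [← Real.log_div (by positivity) (by positivity)]
    have h4 := Real.log_le_sub_one_of_pos
      (show (0:ℝ) < (((N + 1 : ℕ) : ℝ) + 1) / ((N + 1 : ℕ) : ℝ) by positivity)
    have h5 : (((N + 1 : ℕ) : ℝ) + 1) / ((N + 1 : ℕ) : ℝ) - 1 = 1 / ((N + 1 : ℕ) : ℝ) := by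
      field_simp; ring
    rw [h5] at h4
    calc (n:ℝ) * _ ≤ n * (1 / ((N + 1 : ℕ) : ℝ)) := by gcongr
      _ ≤ 1 / 7 := by
        rw [mul_one_div, div_le_div_iff₀ hN0 (by norm_num), hN]
        push_cast; linarith
  by_contra hcon
  have hW : gaussNu (Wset n) ≤ ENNReal.ofReal (1 / 10) := by
    refine (Measure.le_iff'.1 gaussNu_le _).trans ((not_lt.1 hcon).trans ?_)
    rw [ENNReal.ofReal_div_of_pos (by norm_num)]
    simp
  have htot : gaussNu univ ≤ ENNReal.ofReal (1 / 10 + 2 / 5 + 1 / 7) := by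
    rw [ENNReal.ofReal_add (by norm_num) (by norm_num),
      ENNReal.ofReal_add (by norm_num) (by norm_num)]
    calc gaussNu univ ≤ _ := measure_mono hsub
      _ ≤ gaussNu (((Wset n ∪ E1) ∪ E2) ∪ (Ioc (0:ℝ) 1)ᶜ) + 0 := hQ ▸ measure_union_le _ _
      _ ≤ gaussNu ((Wset n ∪ E1) ∪ E2) + 0 + 0 := by
        gcongr; exact gaussNu_compl ▸ measure_union_le _ _
      _ = gaussNu ((Wset n ∪ E1) ∪ E2) := by simp
      _ ≤ gaussNu (Wset n ∪ E1) + gaussNu E2 := measure_union_le _ _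
      _ ≤ gaussNu (Wset n) + gaussNu E1 + gaussNu E2 := by
        gcongr; exact measure_union_le _ _
      _ ≤ _ := by gcongr
  rw [gaussNu_univ, ENNReal.ofReal_le_ofReal_iff (by norm_num)] at htot
  have := Real.log_two_gt_d9
  linarith
end

section
/- Let α ∈ (0,1) be irrational with convergent denominators (q_n), and for i ≥ 1 let h_i(x) = Σ_{j = q_i + q_{i−1}}^{2 q_i + q_{i−1} − 1} χ_{V_j}(x). Then there exist constants C, b > 0 such that for all i, j ≥ 1 with i ≠ j: ∫ h_i h_j dλ − ∫ h_i dλ · ∫ h_j dλ < C·e^{−b·|i−j|}. -/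
open MeasureTheory Filter Set

noncomputable def rot (α : ℝ) : ℝ → ℝ := fun x => Int.fract (x + α)

/-- The denominators of the convergents. -/
noncomputable def cfQ (α : ℝ) : ℕ → ℕ
  | 0 => 1
  | 1 => cfA α 1
  | n + 2 => cfA α (n + 2) * cfQ α (n + 1) + cfQ α n

/-- The coding of the orbit of `x` under the rotation by `α`. -/
noncomputable def code (α x : ℝ) (i : ℕ) : ℕ :=
  if (rot α)^[i] x < α then 0 else 1

/-- The set of points of `[0,1)` that are undetermined at step `j`. -/
def undet (α : ℝ) (j : ℕ) : Set ℝ :=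
  {x ∈ Set.Ico (0:ℝ) 1 | ∃ y ∈ Set.Ico (0:ℝ) 1,
    (∀ i ≤ j, code α y i = code α x i) ∧ code α y (j + 1) ≠ code α x (j + 1)}

/-- `h_i(x) = Σ_{j = q_i + q_{i-1}}^{2 q_i + q_{i-1} - 1} χ_{V_j}(x)`. -/
noncomputable def hFun (α : ℝ) (i : ℕ) (x : ℝ) : ℝ :=
  ∑ j ∈ Finset.Ico (cfQ α i + cfQ α (i - 1)) (2 * cfQ α i + cfQ α (i - 1)),
    Set.indicator (undet α j) (fun _ => (1:ℝ)) x

/-! ### Continued fractions -/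

lemma gm_irr (α : ℝ) (hα : α ∈ Set.Ioo (0:ℝ) 1) (hirr : Irrational α) (n : ℕ) :
    Irrational (gaussMap^[n] α) ∧ 0 < gaussMap^[n] α ∧ gaussMap^[n] α < 1 := by
  induction n with
  | zero => exact ⟨hirr, hα.1, hα.2⟩
  | succ n ih =>
    obtain ⟨h1, h2, h3⟩ := ih
    rw [Function.iterate_succ_apply']
    have hi : Irrational (gaussMap (gaussMap^[n] α)) := by
      unfold gaussMap Int.fract
      rw [one_div]
      exact h1.inv.sub_intCast _
    refine ⟨hi, ?_, Int.fract_lt_one _⟩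
    exact lt_of_le_of_ne (Int.fract_nonneg _) (fun h => hi.ne_zero h.symm)

lemma cfA_eq (α : ℝ) (hα : α ∈ Set.Ioo (0:ℝ) 1) (hirr : Irrational α) (n : ℕ) :
    1 = gaussMap^[n] α * ((cfA α (n + 1) : ℝ) + gaussMap^[n + 1] α) := by
  obtain ⟨h1, h2, h3⟩ := gm_irr α hα hirr n
  have : ((cfA α (n + 1) : ℝ) + gaussMap^[n + 1] α) = 1 / gaussMap^[n] α := by
    rw [Function.iterate_succ_apply']
    unfold cfA
    simp only [Nat.add_sub_cancel]
    conv_lhs => rw [gaussMap]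
    have h0 : 0 ≤ 1 / gaussMap^[n] α := by positivity
    rw [natCast_floor_eq_intCast_floor h0]
    exact Int.floor_add_fract _
  rw [this]; field_simp

lemma cfA_pos (α : ℝ) (hα : α ∈ Set.Ioo (0:ℝ) 1) (hirr : Irrational α) (n : ℕ) :
    1 ≤ cfA α (n + 1) := by
  obtain ⟨h1, h2, h3⟩ := gm_irr α hα hirr n
  unfold cfA
  simp only [Nat.add_sub_cancel]
  apply Nat.le_floor
  rw [Nat.cast_one, le_div_iff₀ h2]; linarith

noncomputable def cfP (α : ℝ) : ℕ → ℤ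
  | 0 => 0
  | 1 => 1
  | n + 2 => (cfA α (n + 2) : ℤ) * cfP α (n + 1) + cfP α n

lemma cfQ_pos (α : ℝ) (hα : α ∈ Set.Ioo (0:ℝ) 1) (hirr : Irrational α) (n : ℕ) :
    1 ≤ cfQ α n ∧ 1 ≤ cfQ α (n + 1) := by
  induction n with
  | zero => exact ⟨le_refl _, cfA_pos α hα hirr 0⟩
  | succ n ih =>
    refine ⟨ih.2, ?_⟩
    show 1 ≤ cfA α (n + 2) * cfQ α (n + 1) + cfQ α n
    have := ih.1
    omega

lemma cfQ_step (α : ℝ) (hα : α ∈ Set.Ioo (0:ℝ) 1) (hirr : Irrational α) (n : ℕ) :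
    cfQ α (n + 1) + cfQ α n ≤ cfQ α (n + 2) := by
  show _ ≤ cfA α (n + 2) * cfQ α (n + 1) + cfQ α n
  have := cfA_pos α hα hirr (n + 1)
  nlinarith

lemma cfQ_mono (α : ℝ) (hα : α ∈ Set.Ioo (0:ℝ) 1) (hirr : Irrational α) (n : ℕ) :
    cfQ α n ≤ cfQ α (n + 1) := by
  cases n with
  | zero => exact cfA_pos α hα hirr 0
  | succ n => exact le_trans (Nat.le_add_right _ _) (cfQ_step α hα hirr n)

lemma theta_rec (α : ℝ) (hα : α ∈ Set.Ioo (0:ℝ) 1) (hirr : Irrational α) (n : ℕ) :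
    (cfQ α (n + 1) : ℝ) * α - cfP α (n + 1) =
      - gaussMap^[n + 1] α * ((cfQ α n : ℝ) * α - cfP α n) := by
  induction n with
  | zero =>
    have := cfA_eq α hα hirr 0
    simp only [Function.iterate_zero, id, zero_add] at this ⊢
    simp only [cfQ, cfP]
    push_cast
    linarith
  | succ n ih =>
    have h := cfA_eq α hα hirr (n + 1)
    obtain ⟨h1, h2, h3⟩ := gm_irr α hα hirr (n + 1)
    simp only [show n + 1 + 1 = n + 2 from rfl] at *
    have e1 : (cfQ α (n + 2) : ℝ) = cfA α (n + 2) * cfQ α (n + 1) + cfQ α n := by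
      simp [cfQ]
    have e2 : (cfP α (n + 2) : ℝ) = cfA α (n + 2) * cfP α (n + 1) + cfP α n := by
      simp [cfP]
    rw [e1, e2]
    set x := gaussMap^[n + 1] α
    set y := gaussMap^[n + 2] α
    set u := (cfQ α (n + 1) : ℝ) * α - cfP α (n + 1) with hu
    set v := (cfQ α n : ℝ) * α - cfP α n with hv
    have : (cfA α (n + 2) : ℝ) * u + v = - y * u := by
      rw [ih]
      linear_combination v * h
    rw [hu, hv] at this
    linarith

lemma det_rec (α : ℝ) (n : ℕ) :
    (cfQ α n : ℤ) * cfP α (n + 1) - cfQ α (n + 1) * cfP α n = (-1) ^ n := by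
  induction n with
  | zero => simp [cfQ, cfP]
  | succ n ih =>
    have e1 : (cfQ α (n + 2) : ℤ) = cfA α (n + 2) * cfQ α (n + 1) + cfQ α n := by
      simp [cfQ]
    have e2 : (cfP α (n + 2) : ℤ) = cfA α (n + 2) * cfP α (n + 1) + cfP α n := by
      simp [cfP]
    simp only [show n + 1 + 1 = n + 2 from rfl]
    rw [e1, e2, pow_succ, ← ih]; ring

/-- Data of two consecutive convergents. -/
structure CFData (α : ℝ) (Q Q' : ℕ) (p p' : ℤ) (x : ℝ) : Prop where
  hQ : 1 ≤ Q
  hQ' : 1 ≤ Q'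
  hx0 : 0 < x
  hx1 : x < 1
  hne : (Q' : ℝ) * α - p' ≠ 0
  hrec : (Q : ℝ) * α - p = - x * ((Q' : ℝ) * α - p')
  hdet : (Q' : ℤ) * p - Q * p' = 1 ∨ (Q' : ℤ) * p - Q * p' = -1
  hsmall : (Q : ℝ) * |(Q' : ℝ) * α - p'| ≤ 1

lemma cfData (α : ℝ) (hα : α ∈ Set.Ioo (0:ℝ) 1) (hirr : Irrational α) (n : ℕ) :
    CFData α (cfQ α (n + 1)) (cfQ α n) (cfP α (n + 1)) (cfP α n) (gaussMap^[n + 1] α) := by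
  obtain ⟨h1, h2, h3⟩ := gm_irr α hα hirr (n + 1)
  have hp := cfQ_pos α hα hirr n
  have hd := det_rec α n
  have hr := theta_rec α hα hirr n
  have hd' : (cfQ α n : ℤ) * cfP α (n + 1) - cfQ α (n + 1) * cfP α n = 1 ∨
      (cfQ α n : ℤ) * cfP α (n + 1) - cfQ α (n + 1) * cfP α n = -1 := by
    rw [hd]; exact neg_one_pow_eq_or ℤ n
  refine ⟨hp.2, hp.1, h2, h3, ?_, hr, hd', ?_⟩
  · have : Irrational ((cfQ α n : ℝ) * α - cfP α n) := by
      apply Irrational.sub_intCast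
      apply hirr.natCast_mul
      omega
    exact this.ne_zero
  · have hQ'0 : (0:ℝ) ≤ cfQ α n := by positivity
    have hQ0 : (0:ℝ) ≤ cfQ α (n + 1) := by positivity
    generalize hv : (cfQ α n : ℝ) * α - cfP α n = v at *
    have key : (cfQ α (n + 1) : ℝ) * v + (cfQ α n : ℝ) * (gaussMap^[n + 1] α * v) =
       (cfQ α n : ℝ) * cfP α (n + 1) - cfQ α (n + 1) * cfP α n := by
      rw [← hv] at hr ⊢
      linear_combination (cfQ α n : ℝ) * hr
    have habs : |(cfQ α (n + 1) : ℝ) * v + (cfQ α n : ℝ) * (gaussMap^[n + 1] α * v)| = 1 := by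
      rw [key]
      rcases hd' with h | h
      · have : (cfQ α n : ℝ) * cfP α (n + 1) - cfQ α (n + 1) * cfP α n = 1 := by exact_mod_cast h
        rw [this]; simp
      · have : (cfQ α n : ℝ) * cfP α (n + 1) - cfQ α (n + 1) * cfP α n = -1 := by exact_mod_cast h
        rw [this]; simp
    rw [show (cfQ α (n + 1) : ℝ) * v + (cfQ α n : ℝ) * (gaussMap^[n + 1] α * v) =
      ((cfQ α (n + 1) : ℝ)  + (cfQ α n : ℝ) * gaussMap^[n + 1] α) * v by ring, abs_mul,
      abs_of_nonneg (by positivity)] at habs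
    have : 0 ≤ (cfQ α n : ℝ) * gaussMap^[n + 1] α * |v| := by positivity
    linarith

lemma cfQ_growth (α : ℝ) (hα : α ∈ Set.Ioo (0:ℝ) 1) (hirr : Irrational α) (r : ℝ) (hr : 0 < r)
    (hr2 : r ^ 2 = 1 / 2) (i d : ℕ) :
    (cfQ α i : ℝ) ≤ 2 * r ^ d * cfQ α (i + d) ∧
    (cfQ α i : ℝ) ≤ 2 * r ^ (d + 1) * cfQ α (i + (d + 1)) := by
  induction d with
  | zero =>
    have h0 : (0:ℝ) ≤ cfQ α i := by positivity
    have h1 : (cfQ α i : ℝ) ≤ cfQ α (i + 1) := by exact_mod_cast cfQ_mono α hα hirr i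
    have h2 : 1 ≤ 2 * r := by nlinarith
    constructor
    · simp; linarith
    · simp; nlinarith
  | succ d ih =>
    refine ⟨ih.2, ?_⟩
    have h1 : (cfQ α (i + d + 1) : ℝ) + cfQ α (i + d) ≤ cfQ α (i + d + 2) := by
      exact_mod_cast cfQ_step α hα hirr (i + d)
    have h2 : (cfQ α (i + d) : ℝ) ≤ cfQ α (i + d + 1) := by exact_mod_cast cfQ_mono α hα hirr _
    have h3 : r ^ (d + 1 + 1) = r ^ d / 2 := by
      rw [show d + 1 + 1 = d + 2 from rfl, pow_add, hr2]; ring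
    rw [h3, show i + (d + 1 + 1) = i + d + 2 from rfl]
    have h4 : 0 < r ^ d := by positivity
    nlinarith [ih.1]

/-! ### Undetermined sets -/

def TS (α : ℝ) (N : ℕ) : Set ℝ :=
  {t | ∀ k : ℕ, 1 ≤ k → k ≤ N → ⌊t - k * α⌋ = ⌊-(k * α)⌋}

lemma rot_iter (α x : ℝ) (hx : x ∈ Set.Ico (0:ℝ) 1) (i : ℕ) :
    (rot α)^[i] x = Int.fract (x + i * α) := by
  induction i with
  | zero => simp [Int.fract_eq_self.2 ⟨hx.1, hx.2⟩]
  | succ i ih =>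
    rw [Function.iterate_succ_apply', ih]
    unfold rot
    rw [Int.fract_eq_fract]
    refine ⟨-⌊x + i * α⌋, ?_⟩
    have := Int.floor_add_fract (x + i * α)
    push_cast
    linarith

lemma code_eq (α : ℝ) (hα : α ∈ Set.Ioo (0:ℝ) 1) (x : ℝ) (hx : x ∈ Set.Ico (0:ℝ) 1) (i : ℕ) :
    (code α x i : ℤ) = 1 - (⌊x + i * α⌋ - ⌊x + i * α - α⌋) := by
  unfold code
  rw [rot_iter α x hx]
  have h1 := Int.floor_add_fract (x + i * α)
  have h2 := Int.fract_nonneg (x + i * α)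
  have h3 := Int.fract_lt_one (x + i * α)
  obtain ⟨a0, a1⟩ := hα
  split_ifs with h
  · have : ⌊x + i * α - α⌋ = ⌊x + i * α⌋ - 1 := by
      rw [Int.floor_eq_iff]; push_cast
      constructor <;> linarith
    rw [this]; push_cast; ring
  · have : ⌊x + i * α - α⌋ = ⌊x + i * α⌋ := by
      rw [Int.floor_eq_iff]
      constructor <;> linarith
    rw [this]; push_cast; ring

lemma codes_agree (α : ℝ) (hα : α ∈ Set.Ioo (0:ℝ) 1) (x y : ℝ) (hx : x ∈ Set.Ico (0:ℝ) 1)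
    (hy : y ∈ Set.Ico (0:ℝ) 1) (j : ℕ) :
    (∀ i ≤ j, code α y i = code α x i) ↔
      (∀ i ≤ j + 1, ⌊y + i * α - α⌋ = ⌊x + i * α - α⌋) := by
  have hx0 : ⌊x⌋ = 0 := Int.floor_eq_zero_iff.2 hx
  have hy0 : ⌊y⌋ = 0 := Int.floor_eq_zero_iff.2 hy
  have e : ∀ z : ℝ, ∀ i : ℕ, z + ((i + 1 : ℕ) : ℝ) * α - α = z + i * α := by
    intro z i; push_cast; ring
  constructor
  · intro h i
    induction i with
    | zero =>
      intro _
      have h0 := h 0 (by omega)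
      have c1 := code_eq α hα x hx 0
      have c2 := code_eq α hα y hy 0
      rw [h0] at c2
      simp only [Nat.cast_zero, zero_mul, add_zero] at *
      rw [hx0] at c1; rw [hy0] at c2
      omega
    | succ i ih =>
      intro hi
      have h0 := h i (by omega)
      have c1 := code_eq α hα x hx i
      have c2 := code_eq α hα y hy i
      have := ih (by omega)
      rw [h0] at c2
      rw [e, e]
      omega
  · intro h i hi
    have c1 := code_eq α hα x hx i
    have c2 := code_eq α hα y hy i
    have h1 := h i (by omega)
    have h2 := h (i + 1) (by omega)
    rw [e, e] at h2
    omega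

lemma codes_agree_succ (α : ℝ) (hα : α ∈ Set.Ioo (0:ℝ) 1) (x y : ℝ) (hx : x ∈ Set.Ico (0:ℝ) 1)
    (hy : y ∈ Set.Ico (0:ℝ) 1) (j : ℕ) :
    ((∀ i ≤ j, code α y i = code α x i) ∧ code α y (j + 1) ≠ code α x (j + 1)) ↔
      ((∀ i ≤ j + 1, ⌊y + i * α - α⌋ = ⌊x + i * α - α⌋) ∧
        ⌊y + (j + 1 : ℕ) * α⌋ ≠ ⌊x + (j + 1 : ℕ) * α⌋) := by
  rw [codes_agree α hα x y hx hy]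
  apply and_congr_right
  intro h
  have c1 := code_eq α hα x hx (j + 1)
  have c2 := code_eq α hα y hy (j + 1)
  have h1 := h (j + 1) le_rfl
  constructor
  · intro h2 h3; apply h2; omega
  · intro h2 h3; apply h2; omega

/-- The new partition point. -/
noncomputable def cpt (α : ℝ) (j : ℕ) : ℝ := Int.fract (-((j + 1 : ℕ) * α))

lemma cpt_spec (α : ℝ) (hirr : Irrational α) (j : ℕ) :
    ∃ M : ℤ, cpt α j = M - (j + 1 : ℕ) * α ∧ 0 < cpt α j ∧ cpt α j < 1 := by
  refine ⟨-⌊-((j + 1 : ℕ) * α)⌋, ?_, ?_, Int.fract_lt_one _⟩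
  · unfold cpt Int.fract; push_cast; ring
  · apply lt_of_le_of_ne (Int.fract_nonneg _)
    intro h
    have : Irrational (-((j + 1 : ℕ) * α)) := (hirr.natCast_mul (by omega)).neg
    have h2 : Irrational (Int.fract (-((j + 1 : ℕ) * α))) := by
      unfold Int.fract; exact this.sub_intCast _
    exact h2.ne_zero h.symm

lemma mem_TS_iff (α : ℝ) (j : ℕ) (M : ℤ) (hM : cpt α j = M - (j + 1 : ℕ) * α) (x : ℝ) :
    x - cpt α j ∈ TS α (j + 2) ↔
      ∀ i ≤ j + 1, ⌊cpt α j + i * α - α⌋ = ⌊x + i * α - α⌋ := by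
  unfold TS
  simp only [Set.mem_ofPred_eq]
  have key : ∀ k i : ℕ, k + i = j + 2 →
    (⌊x - cpt α j - k * α⌋ = ⌊-(k * α)⌋ ↔ ⌊cpt α j + i * α - α⌋ = ⌊x + i * α - α⌋) := by
    intro k i hki
    have hki' : (k : ℝ) + i = j + 2 := by exact_mod_cast hki
    have e1 : x - cpt α j - k * α = (x + i * α - α) - M := by
      rw [hM]; push_cast; linear_combination (-α) * hki'
    have e2 : cpt α j + i * α - α = -(k * α) + M := by
      rw [hM]; push_cast; linear_combination (α) * hki'
    rw [e1, e2, Int.floor_sub_intCast, Int.floor_add_intCast]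
    omega
  constructor
  · intro h i hi
    exact (key (j + 2 - i) i (by omega)).1 (h _ (by omega) (by omega))
  · intro h k hk hk2
    exact (key k (j + 2 - k) (by omega)).2 (h _ (by omega))

lemma undet_aux (α : ℝ) (j : ℕ) (M : ℤ) (hM : cpt α j = M - (j + 1 : ℕ) * α)
    (h01 : cpt α j < 1) (x y : ℝ) (hx : x ∈ Set.Ico (0:ℝ) 1) (hy : y ∈ Set.Ico (0:ℝ) 1)
    (h : ⌊x + (j + 1 : ℕ) * α⌋ < ⌊y + (j + 1 : ℕ) * α⌋) : x ≤ cpt α j ∧ cpt α j ≤ y := by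
  set m := ⌊y + (j + 1 : ℕ) * α⌋ with hm
  have h1 : (m : ℝ) ≤ y + (j + 1 : ℕ) * α := Int.floor_le _
  have h2 : x + (j + 1 : ℕ) * α < m := Int.floor_lt.1 h
  have h3 : cpt α j = m - (j + 1 : ℕ) * α := by
    have h0 : 0 ≤ cpt α j := Int.fract_nonneg _
    obtain ⟨a1, a2⟩ := hx
    obtain ⟨b1, b2⟩ := hy
    have : M = m := by
      have u1 : (M : ℝ) < m + 1 := by linarith
      have u2 : (m : ℝ) < M + 1 := by linarith
      have u1' : M < m + 1 := by exact_mod_cast u1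
      have u2' : m < M + 1 := by exact_mod_cast u2
      omega
    rw [hM, this]
  constructor <;> linarith

lemma floor_left (t : ℝ) (h : Irrational t) : ∃ ε > 0, ∀ s, t - ε < s → s ≤ t → ⌊s⌋ = ⌊t⌋ := by
  have h2 : Irrational (Int.fract t) := by unfold Int.fract; exact h.sub_intCast _
  have h3 : 0 < Int.fract t := lt_of_le_of_ne (Int.fract_nonneg _) (fun h => h2.ne_zero h.symm)
  refine ⟨Int.fract t, h3, ?_⟩
  intro s hs1 hs2
  have h1 := Int.floor_add_fract t
  have := Int.lt_floor_add_one t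
  rw [Int.floor_eq_iff]
  constructor <;> linarith

lemma TS_left (α : ℝ) (hirr : Irrational α) (N : ℕ) :
    ∃ ε > 0, ∀ t, -ε < t → t ≤ 0 → t ∈ TS α N := by
  induction N with
  | zero =>
    refine ⟨1, one_pos, ?_⟩
    intro t _ _ k hk hk2
    omega
  | succ N ih =>
    obtain ⟨ε, he, h⟩ := ih
    obtain ⟨δ, hd, h'⟩ := floor_left (-((N + 1 : ℕ) * α)) (hirr.natCast_mul (by omega)).neg
    refine ⟨min ε δ, lt_min he hd, ?_⟩
    intro t ht ht0 k hk hk2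
    have m1 := min_le_left ε δ
    have m2 := min_le_right ε δ
    by_cases hkN : k ≤ N
    · exact h t (by linarith) ht0 k hk hkN
    · have : k = N + 1 := by omega
      subst this
      apply h' <;> linarith

lemma undet_eq (α : ℝ) (hα : α ∈ Set.Ioo (0:ℝ) 1) (hirr : Irrational α) (j : ℕ) :
    undet α j = {x | x - cpt α j ∈ TS α (j + 2)} := by
  obtain ⟨M, hM, h0, h1⟩ := cpt_spec α hirr j
  ext x
  simp only [undet, Set.mem_ofPred_eq]
  rw [mem_TS_iff α j M hM]
  have hc : cpt α j ∈ Set.Ico (0:ℝ) 1 := ⟨h0.le, h1⟩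
  constructor
  · rintro ⟨hx, y, hy, h⟩
    rw [codes_agree_succ α hα x y hx hy] at h
    obtain ⟨h2, h3⟩ := h
    intro i hi
    have h4 := h2 i hi
    rcases lt_or_gt_of_ne h3 with h5 | h5
    · obtain ⟨u1, u2⟩ := undet_aux α j M hM h1 y x hy hx h5
      apply le_antisymm
      · apply Int.floor_mono; linarith
      · rw [← h4]; apply Int.floor_mono; linarith
    · obtain ⟨u1, u2⟩ := undet_aux α j M hM h1 x y hx hy h5
      apply le_antisymm
      · rw [← h4]; apply Int.floor_mono; linarith
      · apply Int.floor_mono; linarith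
  · intro h
    have hx : x ∈ Set.Ico (0:ℝ) 1 := by
      have := h 1 (by omega)
      simp only [Nat.cast_one, one_mul, add_sub_cancel_right] at this
      rw [Int.floor_eq_zero_iff.2 hc] at this
      exact Int.floor_eq_zero_iff.1 this.symm
    refine ⟨hx, ?_⟩
    have hcf : ⌊cpt α j + (j + 1 : ℕ) * α⌋ = M := by
      rw [hM, sub_add_cancel, Int.floor_intCast]
    by_cases hxc : x < cpt α j
    · refine ⟨cpt α j, hc, ?_⟩
      rw [codes_agree_succ α hα x _ hx hc]
      refine ⟨h, ?_⟩
      rw [hcf]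
      apply ne_of_gt
      rw [Int.floor_lt]; linarith
    · obtain ⟨ε, he, hT⟩ := TS_left α hirr (j + 2)
      set y := cpt α j - min (ε / 2) (cpt α j) with hy
      have m1 := min_le_left (ε / 2) (cpt α j)
      have m2 := min_le_right (ε / 2) (cpt α j)
      have m3 : 0 < min (ε / 2) (cpt α j) := lt_min (by linarith) h0
      have hyI : y ∈ Set.Ico (0:ℝ) 1 := ⟨by linarith, by linarith⟩
      refine ⟨y, hyI, ?_⟩
      rw [codes_agree_succ α hα x y hx hyI]
      have := hT (y - cpt α j) (by linarith) (by linarith)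
      rw [mem_TS_iff α j M hM] at this
      refine ⟨fun i hi => by rw [← h i hi, this i hi], ?_⟩
      apply ne_of_lt
      apply Int.floor_lt.2 _ |>.trans_le
      · exact (le_of_eq hcf.symm).trans (Int.floor_mono (by linarith))
      · linarith

lemma TS_Ico (α : ℝ) (N : ℕ) : ∃ a b : ℝ, a ≤ 0 ∧ 0 ≤ b ∧ TS α (N + 1) = Set.Ico a b := by
  have key : ∀ k : ℕ, {t : ℝ | ⌊t - k * α⌋ = ⌊-(k * α)⌋} =
      Set.Ico (-Int.fract (-(k * α))) (1 - Int.fract (-(k * α))) := by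
    intro k
    ext t
    simp only [Set.mem_ofPred_eq, Set.mem_Ico, Int.floor_eq_iff, Int.fract]
    constructor <;> rintro ⟨h1, h2⟩ <;> constructor <;> linarith
  have f1 : ∀ k : ℕ, 0 ≤ Int.fract (-(k * α)) := fun k => Int.fract_nonneg _
  have f2 : ∀ k : ℕ, Int.fract (-(k * α)) < 1 := fun k => Int.fract_lt_one _
  induction N with
  | zero =>
    refine ⟨-Int.fract (-((1 : ℕ) * α)), 1 - Int.fract (-((1 : ℕ) * α)), ?_, ?_, ?_⟩
    rotate_left 2
    · rw [← key 1]
      ext t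
      simp only [TS, Set.mem_ofPred_eq]
      constructor
      · intro h; exact h 1 le_rfl le_rfl
      · intro h k hk1 hk2
        have : k = 1 := by omega
        subst this; exact h
    · linarith [f1 1]
    · linarith [f2 1]
  | succ N ih =>
    obtain ⟨a, b, ha, hb, h⟩ := ih
    refine ⟨max a (-Int.fract (-((N + 1 + 1 : ℕ) * α))),
      min b (1 - Int.fract (-((N + 1 + 1 : ℕ) * α))), ?_, ?_, ?_⟩
    rotate_left 2
    · have : TS α (N + 1 + 1) = TS α (N + 1) ∩
          {t : ℝ | ⌊t - (N + 1 + 1 : ℕ) * α⌋ = ⌊-((N + 1 + 1 : ℕ) * α)⌋} := by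
        ext t
        simp only [TS, Set.mem_ofPred_eq, Set.mem_inter_iff]
        constructor
        · intro h
          exact ⟨fun k h1 h2 => h k h1 (by omega), h _ (by omega) le_rfl⟩
        · rintro ⟨h, h'⟩ k h1 h2
          by_cases hk : k ≤ N + 1
          · exact h k h1 hk
          · have : k = N + 1 + 1 := by omega
            subst this; exact h'
      rw [this, h, key, Set.Ico_inter_Ico]
    · exact max_le ha (by linarith [f1 (N + 1 + 1)])
    · exact le_min hb (by linarith [f2 (N + 1 + 1)])

lemma TS_anti (α : ℝ) {N N' : ℕ} (h : N ≤ N') : TS α N' ⊆ TS α N :=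
  fun _ ht k h1 h2 => ht k h1 (h2.trans h)

/-! ### Arithmetic of the convergents -/

lemma TS_bounds (α : ℝ) (Q Q' : ℕ) (p p' : ℤ) (x : ℝ) (D : CFData α Q Q' p p' x)
    (t : ℝ) (ht : t ∈ TS α (Q + Q')) :
    (0 < (Q' : ℝ) * α - p' → -(x * ((Q' : ℝ) * α - p')) ≤ t ∧ t < (1 - x) * ((Q' : ℝ) * α - p')) ∧
    ((Q' : ℝ) * α - p' < 0 → (1 - x) * ((Q' : ℝ) * α - p') ≤ t ∧ t < -(x * ((Q' : ℝ) * α - p'))) := by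
  obtain ⟨hQ, hQ', hx0, hx1, hne, hrec, hdet, hsmall⟩ := D
  have h1 := ht Q hQ (by omega)
  have h2 := ht (Q + Q') (by omega) le_rfl
  set v := (Q' : ℝ) * α - p' with hv
  have hQr : (1:ℝ) ≤ Q := by exact_mod_cast hQ
  have hvabs : |v| ≤ 1 := by nlinarith [abs_nonneg v]
  obtain ⟨v1, v2⟩ := abs_le.1 hvabs
  have e1 : -((Q : ℝ) * α) = x * v - p := by linarith
  have e2 : -(((Q + Q' : ℕ) : ℝ) * α) = -((1 - x) * v) - (p + p' : ℤ) := by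
    push_cast; linear_combination -hrec - hv
  have e1' : t - (Q : ℝ) * α = (t + x * v) - p := by linarith
  have e2' : t - ((Q + Q' : ℕ) : ℝ) * α = (t - (1 - x) * v) - (p + p' : ℤ) := by linarith
  rw [e1, e1', Int.floor_sub_intCast, Int.floor_sub_intCast] at h1
  rw [e2, e2', Int.floor_sub_intCast, Int.floor_sub_intCast] at h2
  constructor
  · intro hpos
    have f1 : ⌊x * v⌋ = 0 := by
      rw [Int.floor_eq_zero_iff]; constructor <;> nlinarith
    have f2 : ⌊-((1 - x) * v)⌋ = -1 := by
      rw [Int.floor_eq_iff]; push_cast; constructor <;> nlinarith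
    rw [f1] at h1; rw [f2] at h2
    have h1 : ⌊t + x * v⌋ = 0 := by omega
    have h2 : ⌊t - (1 - x) * v⌋ = -1 := by omega
    rw [Int.floor_eq_iff] at h1 h2
    push_cast at h1 h2
    constructor <;> linarith [h1.1, h2.2]
  · intro hneg
    have f1 : ⌊x * v⌋ = -1 := by
      rw [Int.floor_eq_iff]; push_cast; constructor <;> nlinarith
    have f2 : ⌊-((1 - x) * v)⌋ = 0 := by
      rw [Int.floor_eq_zero_iff]; constructor <;> nlinarith
    rw [f1] at h1; rw [f2] at h2
    have h1 : ⌊t + x * v⌋ = -1 := by omega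
    have h2 : ⌊t - (1 - x) * v⌋ = 0 := by omega
    rw [Int.floor_eq_iff] at h1 h2
    push_cast at h1 h2
    constructor <;> linarith [h1.2, h2.1]

lemma no_approx (α : ℝ) (Q Q' : ℕ) (p p' : ℤ) (x : ℝ) (D : CFData α Q Q' p p' x)
    (k : ℕ) (hk : 1 ≤ k) (hk2 : k < 2 * Q + Q') (m : ℤ) (w : ℝ)
    (hw : (k : ℝ) * α - m = w * ((Q' : ℝ) * α - p')) (hw0 : w ≠ 0) (hw1 : -x < w)
    (hw2 : w < 1 - x) : False := by
  obtain ⟨hQ, hQ', hx0, hx1, hne, hrec, hdet, hsmall⟩ := D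
  have huv : ∃ u v : ℤ, (k : ℤ) = u * Q + v * Q' ∧ m = u * p + v * p' := by
    rcases hdet with h | h
    · refine ⟨Q' * m - p' * k, p * k - Q * m, ?_, ?_⟩
      · linear_combination (-(k:ℤ)) * h
      · linear_combination (-m) * h
    · refine ⟨-(Q' * m - p' * k), -(p * k - Q * m), ?_, ?_⟩
      · linear_combination ((k:ℤ)) * h
      · linear_combination (m) * h
  obtain ⟨u, v, h1, h2⟩ := huv
  have h1r : (k : ℝ) = u * Q + v * Q' := by exact_mod_cast h1
  have h2r : (m : ℝ) = u * p + v * p' := by exact_mod_cast h2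
  have hw' : w = v - u * x := by
    apply mul_right_cancel₀ hne
    rw [← hw, h1r, h2r]
    linear_combination (u : ℝ) * hrec
  have hkz : (1 : ℤ) ≤ k := by exact_mod_cast hk
  have hk2z : (k : ℤ) < 2 * Q + Q' := by exact_mod_cast hk2
  have hQz : (1 : ℤ) ≤ Q := by exact_mod_cast hQ
  have hQz' : (1 : ℤ) ≤ Q' := by exact_mod_cast hQ'
  rcases le_or_gt v 0 with hv | hv
  · rcases le_or_gt u 0 with hu | hu
    · nlinarith
    · have hvr : (v : ℝ) ≤ 0 := by exact_mod_cast hv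
      have hur : (1 : ℝ) ≤ u := by exact_mod_cast hu
      nlinarith
  · have hvr : (1 : ℝ) ≤ v := by exact_mod_cast hv
    have hu : 2 ≤ u := by
      by_contra hcon
      have : (u : ℝ) ≤ 1 := by exact_mod_cast (by omega : u ≤ 1)
      nlinarith
    nlinarith

lemma TS_const (α : ℝ) (hirr : Irrational α) (Q Q' : ℕ) (p p' : ℤ) (x : ℝ)
    (D : CFData α Q Q' p p' x) (N : ℕ) (hN : N < 2 * Q + Q') : TS α (Q + Q') ⊆ TS α N := by
  intro t ht k hk hkN
  by_contra hcon
  obtain ⟨b1, b2⟩ := TS_bounds α Q Q' p p' x D t ht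
  have hne := D.hne
  have hx0 := D.hx0
  have hx1 := D.hx1
  have ik : Irrational ((k : ℝ) * α) := hirr.natCast_mul (by omega)
  have hm : ∃ m : ℤ, (k : ℝ) * α - m ≠ 0 ∧
      ((t < (k : ℝ) * α - m ∧ (k : ℝ) * α - m < 0) ∨
       (0 < (k : ℝ) * α - m ∧ (k : ℝ) * α - m ≤ t)) := by
    rcases lt_or_gt_of_ne hcon with h | h
    · refine ⟨-⌊-((k : ℝ) * α)⌋, (ik.sub_intCast _).ne_zero, Or.inl ?_⟩
      have n0 := (ik.sub_intCast (-⌊-((k : ℝ) * α)⌋)).ne_zero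
      have l1 := Int.floor_le (-((k : ℝ) * α))
      have l2 := Int.floor_lt.1 h
      push_cast at n0 ⊢
      refine ⟨by linarith, lt_of_le_of_ne (by linarith) n0⟩
    · refine ⟨-⌊t - (k : ℝ) * α⌋, (ik.sub_intCast _).ne_zero, Or.inr ?_⟩
      have l1 := Int.floor_le (t - (k : ℝ) * α)
      have l2 := Int.floor_lt.1 h
      push_cast
      constructor <;> linarith
  obtain ⟨m, hm0, hm⟩ := hm
  set v := (Q' : ℝ) * α - p' with hv
  set z := (k : ℝ) * α - m with hz
  have hw : z = z / v * v := by field_simp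
  apply no_approx α Q Q' p p' x D k hk (by omega) m (z / v) hw (div_ne_zero hm0 hne)
  · rcases lt_or_gt_of_ne hne with h | h
    · obtain ⟨c1, c2⟩ := b2 h
      rw [lt_div_iff_of_neg h]
      rcases hm with hm | hm <;> nlinarith
    · obtain ⟨c1, c2⟩ := b1 h
      rw [lt_div_iff₀ h]
      rcases hm with hm | hm <;> nlinarith
  · rcases lt_or_gt_of_ne hne with h | h
    · obtain ⟨c1, c2⟩ := b2 h
      rw [div_lt_iff_of_neg h]
      rcases hm with hm | hm <;> nlinarith
    · obtain ⟨c1, c2⟩ := b1 h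
      rw [div_lt_iff₀ h]
      rcases hm with hm | hm <;> nlinarith

lemma TS_vol (α : ℝ) (Q Q' : ℕ) (p p' : ℤ) (x : ℝ)
    (D : CFData α Q Q' p p' x) : (Q : ℝ) * volume.real (TS α (Q + Q')) ≤ 1 := by
  have hb := TS_bounds α Q Q' p p' x D
  refine le_trans ?_ D.hsmall
  apply mul_le_mul_of_nonneg_left _ (by positivity)
  set v := (Q' : ℝ) * α - p' with hv
  rcases lt_or_gt_of_ne D.hne with h | h
  · have : TS α (Q + Q') ⊆ Set.Ico ((1 - x) * v) (-(x * v)) := fun t ht => (hb t ht).2 h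
    refine (measureReal_mono this (by simp)).trans ?_
    rw [Real.volume_real_Ico, abs_of_neg h]
    apply max_le <;> linarith
  · have : TS α (Q + Q') ⊆ Set.Ico (-(x * v)) ((1 - x) * v) := fun t ht => (hb t ht).1 h
    refine (measureReal_mono this (by simp)).trans ?_
    rw [Real.volume_real_Ico, abs_of_pos h]
    apply max_le <;> linarith

/-- Denjoy-Koksma count. -/
lemma count_le (α : ℝ) (Q Q' : ℕ) (p p' : ℤ) (x : ℝ)
    (D : CFData α Q Q' p p' x) (L : ℕ) (a b : ℝ) (hab : a ≤ b) :
    (((Finset.Ico L (L + Q)).filter (fun l => cpt α l ∈ Set.Ico a b)).card : ℝ)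
      ≤ Q * (b - a) + 3 := by
  obtain ⟨hQ, hQ', hx0, hx1, hne, hrec, hdet, hsmall⟩ := D
  have hQr : (1:ℝ) ≤ Q := by exact_mod_cast hQ
  have hθ : |(Q : ℝ) * α - p| * Q ≤ 1 := by
    rw [hrec, abs_mul, abs_neg, abs_of_pos hx0]
    nlinarith [abs_nonneg ((Q' : ℝ) * α - p')]
  have hcop : IsCoprime (Q : ℤ) p := by
    rcases hdet with h | h
    · exact ⟨-p', Q', by linarith⟩
    · exact ⟨p', -Q', by linarith⟩
  set β : ℝ := ((L : ℝ) + 1) * α with hβ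
  set u : ℝ := Q * (a + β) - 1 with hu
  set w : ℝ := Q * (b + β) + 1 with hw
  let f : ℕ → ℤ := fun l => (-⌊-((l + 1 : ℕ) * α)⌋) * Q - ((l : ℤ) - L) * p
  have hcard : ((Finset.Ico L (L + Q)).filter (fun l => cpt α l ∈ Set.Ico a b)).card ≤
      (Finset.Icc ⌈u⌉ ⌊w⌋).card := by
    apply Finset.card_le_card_of_injOn f
    · intro l hl
      simp only [Finset.coe_filter, Finset.mem_Ico, Set.mem_ofPred_eq] at hl
      obtain ⟨⟨hl1, hl2⟩, hl3, hl4⟩ := hl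
      have hc : cpt α l = (-⌊-((l + 1 : ℕ) * α)⌋ : ℤ) - (l + 1 : ℕ) * α := by
        unfold cpt Int.fract; push_cast; ring
      have hf : (f l : ℝ) = Q * (cpt α l + β) + ((l : ℝ) - L) * (Q * α - p) := by
        rw [hc]; simp only [f]; push_cast; ring
      have hs0 : (0:ℝ) ≤ (l : ℝ) - L := by
        have : (L : ℝ) ≤ l := by exact_mod_cast hl1
        linarith
      have hs1 : (l : ℝ) - L ≤ Q := by
        have : (l : ℝ) ≤ L + Q := by exact_mod_cast hl2.le
        linarith
      have hs : |((l : ℝ) - L) * (Q * α - p)| ≤ 1 := by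
        rw [abs_mul, abs_of_nonneg hs0]
        nlinarith [abs_nonneg ((Q : ℝ) * α - p)]
      obtain ⟨s1, s2⟩ := abs_le.1 hs
      simp only [Finset.coe_Icc, Set.mem_Icc]
      rw [Int.ceil_le, Int.le_floor, hf]
      constructor <;> nlinarith
    · intro l hl l' hl' hll
      simp only [Finset.coe_filter, Finset.mem_Ico, Set.mem_ofPred_eq] at hl hl'
      simp only [f] at hll
      have hdvd : (Q : ℤ) ∣ ((l : ℤ) - l') * p := by
        refine ⟨(-⌊-((l + 1 : ℕ) * α)⌋) - (-⌊-((l' + 1 : ℕ) * α)⌋), ?_⟩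
        linear_combination (-1 : ℤ) * hll
      have hd2 := hcop.dvd_of_dvd_mul_right hdvd
      have := Int.eq_zero_of_abs_lt_dvd hd2 (by rw [abs_lt]; constructor <;> omega)
      omega
  have hcast : (((Finset.Ico L (L + Q)).filter (fun l => cpt α l ∈ Set.Ico a b)).card : ℝ) ≤
      ((Finset.Icc ⌈u⌉ ⌊w⌋).card : ℝ) := by exact_mod_cast hcard
  refine hcast.trans ?_
  have huw : w - u = Q * (b - a) + 2 := by rw [hu, hw]; ring
  have hpos : 0 ≤ (Q : ℝ) * (b - a) := mul_nonneg (by positivity) (by linarith)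
  rw [Int.card_Icc]
  have h1 := Int.floor_le w
  have h2 := Int.le_ceil u
  rcases le_or_gt 0 (⌊w⌋ + 1 - ⌈u⌉) with h | h
  · have : (((⌊w⌋ + 1 - ⌈u⌉).toNat : ℤ) : ℝ) = ((⌊w⌋ + 1 - ⌈u⌉ : ℤ) : ℝ) := by
      rw [Int.toNat_of_nonneg h]
    push_cast at this
    rw [this]; linarith
  · rw [Int.toNat_of_nonpos h.le]; push_cast; linarith

/-! ### Measure estimates -/

lemma TS_meas (α : ℝ) (N : ℕ) (hN : 1 ≤ N) : MeasurableSet (TS α N) ∧ volume (TS α N) ≠ ⊤ := by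
  obtain ⟨a, b, -, -, h⟩ := TS_Ico α (N - 1)
  rw [show N - 1 + 1 = N by omega] at h
  rw [h]
  exact ⟨measurableSet_Ico, by simp⟩

lemma shift_vol (S : Set ℝ) (c : ℝ) :
    volume.real {x | x - c ∈ S} = volume.real S := by
  have : {x | x - c ∈ S} = (fun x => x + (-c)) ⁻¹' S := by
    ext x; simp [sub_eq_add_neg]
  unfold Measure.real
  rw [this, measure_preimage_add_right]

lemma overlap_term (T I : Set ℝ) (hI : MeasurableSet I) (c : ℝ) :
    volume.real (I ∩ {x | x - c ∈ T}) = ∫ t in T, Set.indicator I (fun _ => (1:ℝ)) (t + c) := by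
  have h1 : (fun t => Set.indicator I (fun _ => (1:ℝ)) (t + c)) =
      Set.indicator ((fun t => t + c) ⁻¹' I) (fun _ => (1:ℝ)) := by
    ext t; rfl
  have hm : MeasurableSet ((fun t => t + c) ⁻¹' I) := (measurable_id.add_const c) hI
  rw [h1, setIntegral_indicator hm, setIntegral_const, smul_eq_mul, mul_one]
  unfold Measure.real
  rw [← measure_preimage_add_right volume c (I ∩ {x | x - c ∈ T})]
  congr 2
  ext t
  simp [and_comm]

lemma overlap_sum (α : ℝ) (Q Q' : ℕ) (p p' : ℤ) (x : ℝ)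
    (D : CFData α Q Q' p p' x) (L : ℕ) (a b : ℝ) (hab : a ≤ b) :
    ∑ l ∈ Finset.Ico L (L + Q), volume.real (Set.Ico a b ∩ {x | x - cpt α l ∈ TS α (Q + Q')})
      ≤ volume.real (TS α (Q + Q')) * (Q * (b - a) + 3) := by
  have hQ := D.hQ
  obtain ⟨hT, hT2⟩ := TS_meas α (Q + Q') (by omega)
  set T := TS α (Q + Q')
  have hint : ∀ c : ℝ, IntegrableOn
      (fun t => Set.indicator (Set.Ico a b) (fun _ => (1:ℝ)) (t + c)) T := by
    intro c
    have h1 : (fun t => Set.indicator (Set.Ico a b) (fun _ => (1:ℝ)) (t + c)) =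
      Set.indicator ((fun t => t + c) ⁻¹' (Set.Ico a b)) (fun _ => (1:ℝ)) := by
      ext t; rfl
    have hm : MeasurableSet ((fun t => t + c) ⁻¹' (Set.Ico a b)) :=
      (measurable_id.add_const c) measurableSet_Ico
    rw [h1]
    exact (integrableOn_const hT2).indicator hm
  simp_rw [overlap_term T (Set.Ico a b) measurableSet_Ico]
  rw [← integral_finsetSum _ (fun l _ => hint _)]
  calc _ ≤ ∫ t in T, ((Q : ℝ) * (b - a) + 3) := by
        apply setIntegral_mono_on (integrable_finsetSum _ (fun l _ => hint _))
          (integrableOn_const hT2) hT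
        intro t ht
        have := count_le α Q Q' p p' x D L (a - t) (b - t) (by linarith)
        rw [show b - t - (a - t) = b - a by ring] at this
        refine le_trans (le_of_eq ?_) this
        rw [Finset.card_filter]
        push_cast
        apply Finset.sum_congr rfl
        intro l _
        simp only [Set.indicator, Set.mem_Ico]
        congr 1
        simp only [eq_iff_iff]
        constructor <;> rintro ⟨h1, h2⟩ <;> constructor <;> linarith
    _ = _ := by rw [setIntegral_const, smul_eq_mul]

lemma undet_Ico (α : ℝ) (hα : α ∈ Set.Ioo (0:ℝ) 1) (hirr : Irrational α) (j : ℕ) :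
    ∃ a b : ℝ, a ≤ b ∧ undet α j = Set.Ico a b := by
  obtain ⟨a, b, ha, hb, h⟩ := TS_Ico α (j + 1)
  refine ⟨a + cpt α j, b + cpt α j, by linarith, ?_⟩
  rw [undet_eq α hα hirr, h]
  ext x
  simp only [Set.mem_ofPred_eq, Set.mem_Ico]
  constructor <;> rintro ⟨h1, h2⟩ <;> constructor <;> linarith

lemma undet_sub (α : ℝ) (j : ℕ) : undet α j ⊆ Set.Ico (0:ℝ) 1 := fun _ h => h.1

lemma cov_k (α : ℝ) (hα : α ∈ Set.Ioo (0:ℝ) 1) (hirr : Irrational α)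
    (Q Q' : ℕ) (p p' : ℤ) (x : ℝ) (D : CFData α Q Q' p p' x) (k : ℕ) :
    ∑ l ∈ Finset.Ico (Q + Q') (2 * Q + Q'), volume.real (undet α k ∩ undet α l) ≤
      volume.real (undet α k) *
        ∑ l ∈ Finset.Ico (Q + Q') (2 * Q + Q'), volume.real (undet α l) + 5 / Q := by
  have hQ := D.hQ
  have hQr : (1:ℝ) ≤ Q := by exact_mod_cast hQ
  obtain ⟨a, b, hab, hI⟩ := undet_Ico α hα hirr k
  have hvk : volume.real (undet α k) = b - a := by
    rw [hI, Real.volume_real_Ico, max_eq_left (by linarith)]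
  have hvk1 : b - a ≤ 1 := by
    rw [← hvk]
    refine (measureReal_mono (undet_sub α k) (by simp)).trans ?_
    rw [Real.volume_real_Ico]; norm_num
  obtain ⟨hT, hT2⟩ := TS_meas α (Q + Q') (by omega)
  have hTv := TS_vol α Q Q' p p' x D
  have hsum := overlap_sum α Q Q' p p' x D (Q + Q') a b hab
  have hconst := fun N hN => TS_const α hirr Q Q' p p' x D N hN
  set T := TS α (Q + Q') with hTdef
  rw [show Q + Q' + Q = 2 * Q + Q' by ring] at hsum
  have up : ∑ l ∈ Finset.Ico (Q + Q') (2 * Q + Q'), volume.real (undet α k ∩ undet α l) ≤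
      volume.real T * (Q * (b - a) + 3) := by
    refine le_trans (Finset.sum_le_sum ?_) hsum
    intro l hl
    rw [Finset.mem_Ico] at hl
    rw [← hI, undet_eq α hα hirr l]
    apply measureReal_mono
    · apply Set.inter_subset_inter_right
      intro y hy
      exact TS_anti α (by omega : Q + Q' ≤ l + 2) hy
    · apply ne_top_of_le_ne_top _ (measure_mono Set.inter_subset_left)
      rw [hI]; simp
  have low : ((Q : ℝ) - 2) * volume.real T ≤
      ∑ l ∈ Finset.Ico (Q + Q') (2 * Q + Q'), volume.real (undet α l) := by
    have h1 : ∑ l ∈ Finset.Ico (Q + Q') (2 * Q + Q' - 2), volume.real (undet α l) ≤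
        ∑ l ∈ Finset.Ico (Q + Q') (2 * Q + Q'), volume.real (undet α l) := by
      apply Finset.sum_le_sum_of_subset_of_nonneg
      · apply Finset.Ico_subset_Ico_right; omega
      · intros; exact measureReal_nonneg
    refine le_trans ?_ h1
    have h2 : ∀ l ∈ Finset.Ico (Q + Q') (2 * Q + Q' - 2),
        volume.real (undet α l) = volume.real T := by
      intro l hl
      rw [Finset.mem_Ico] at hl
      rw [undet_eq α hα hirr l, shift_vol]
      congr 1
      exact subset_antisymm (TS_anti α (by omega)) (hconst _ (by omega))
    rw [Finset.sum_congr rfl h2, Finset.sum_const, Nat.card_Ico, nsmul_eq_mul]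
    apply mul_le_mul_of_nonneg_right _ measureReal_nonneg
    have : (Q : ℝ) ≤ ((2 * Q + Q' - 2 - (Q + Q') : ℕ) : ℝ) + 2 := by
      exact_mod_cast (by omega : Q ≤ (2 * Q + Q' - 2 - (Q + Q')) + 2)
    linarith
  have hTQ : volume.real T ≤ 1 / Q := by
    rw [le_div_iff₀ (by linarith)]; linarith
  have hT0 : 0 ≤ volume.real T := measureReal_nonneg
  rw [hvk]
  have h5 : (5:ℝ) / Q = 5 * (1 / Q) := by ring
  rw [h5]
  have := mul_le_mul_of_nonneg_left low (by linarith : 0 ≤ b - a)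
  nlinarith

lemma cov_main (α : ℝ) (hα : α ∈ Set.Ioo (0:ℝ) 1) (hirr : Irrational α) (i n : ℕ) :
    (∫ x in Set.Ico (0:ℝ) 1, hFun α i x * hFun α (n + 1) x) -
          (∫ x in Set.Ico (0:ℝ) 1, hFun α i x) * (∫ x in Set.Ico (0:ℝ) 1, hFun α (n + 1) x)
        ≤ 5 * (cfQ α i / cfQ α (n + 1)) := by
  have hmeas : ∀ j, MeasurableSet (undet α j) := by
    intro j
    obtain ⟨a, b, -, h⟩ := undet_Ico α hα hirr j
    rw [h]; exact measurableSet_Ico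
  have hi1 : ∀ S : Set ℝ, MeasurableSet S →
      IntegrableOn (Set.indicator S (fun _ => (1:ℝ))) (Set.Ico (0:ℝ) 1) := by
    intro S hS
    exact (integrableOn_const (by simp)).indicator hS
  have hi2 : ∀ S : Set ℝ, MeasurableSet S → S ⊆ Set.Ico (0:ℝ) 1 →
      ∫ x in Set.Ico (0:ℝ) 1, Set.indicator S (fun _ => (1:ℝ)) x = volume.real S := by
    intro S hS hsub
    rw [setIntegral_indicator hS, Set.inter_eq_self_of_subset_right hsub, setIntegral_const]
    simp
  have hh : ∀ m, ∫ x in Set.Ico (0:ℝ) 1, hFun α m x =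
      ∑ l ∈ Finset.Ico (cfQ α m + cfQ α (m - 1)) (2 * cfQ α m + cfQ α (m - 1)),
        volume.real (undet α l) := by
    intro m
    unfold hFun
    rw [integral_finsetSum _ (fun l _ => hi1 _ (hmeas l))]
    exact Finset.sum_congr rfl (fun l _ => hi2 _ (hmeas l) (undet_sub α l))
  have hprod : ∫ x in Set.Ico (0:ℝ) 1, hFun α i x * hFun α (n + 1) x =
      ∑ k ∈ Finset.Ico (cfQ α i + cfQ α (i - 1)) (2 * cfQ α i + cfQ α (i - 1)),
      ∑ l ∈ Finset.Ico (cfQ α (n + 1) + cfQ α n) (2 * cfQ α (n + 1) + cfQ α n),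
        volume.real (undet α k ∩ undet α l) := by
    have e : ∀ x, hFun α i x * hFun α (n + 1) x =
      ∑ k ∈ Finset.Ico (cfQ α i + cfQ α (i - 1)) (2 * cfQ α i + cfQ α (i - 1)),
      ∑ l ∈ Finset.Ico (cfQ α (n + 1) + cfQ α n) (2 * cfQ α (n + 1) + cfQ α n),
        Set.indicator (undet α k ∩ undet α l) (fun _ => (1:ℝ)) x := by
      intro x
      unfold hFun
      rw [Nat.add_sub_cancel, Finset.sum_mul_sum]
      refine Finset.sum_congr rfl (fun k _ => Finset.sum_congr rfl (fun l _ => ?_))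
      by_cases h1 : x ∈ undet α k <;> by_cases h2 : x ∈ undet α l <;>
        simp [Set.indicator, h1, h2]
    simp_rw [e]
    have hm : ∀ k l, MeasurableSet (undet α k ∩ undet α l) := fun k l => (hmeas k).inter (hmeas l)
    rw [integral_finsetSum _ (fun k _ => integrable_finsetSum _ (fun l _ => hi1 _ (hm k l)))]
    refine Finset.sum_congr rfl (fun k _ => ?_)
    rw [integral_finsetSum _ (fun l _ => hi1 _ (hm k l))]
    exact Finset.sum_congr rfl (fun l _ => hi2 _ (hm k l)
      (Set.inter_subset_left.trans (undet_sub α k)))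
  rw [hprod, hh, hh, Nat.add_sub_cancel]
  have hk := cov_k α hα hirr _ _ _ _ _ (cfData α hα hirr n)
  have hs := Finset.sum_le_sum (fun k (_ : k ∈ Finset.Ico (cfQ α i + cfQ α (i - 1))
    (2 * cfQ α i + cfQ α (i - 1))) => hk k)
  rw [Finset.sum_add_distrib, ← Finset.sum_mul, Finset.sum_const, Nat.card_Ico,
    show 2 * cfQ α i + cfQ α (i - 1) - (cfQ α i + cfQ α (i - 1)) = cfQ α i by omega,
    nsmul_eq_mul] at hs
  have : (cfQ α i : ℝ) * (5 / cfQ α (n + 1)) = 5 * (cfQ α i / cfQ α (n + 1)) := by ring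
  linarith

theorem stmt17 (α : ℝ) (hα : α ∈ Set.Ioo (0:ℝ) 1) (hirr : Irrational α) :
    ∃ C b : ℝ, 0 < C ∧ 0 < b ∧ ∀ i j : ℕ, 1 ≤ i → 1 ≤ j → i ≠ j →
      (∫ x in Set.Ico (0:ℝ) 1, hFun α i x * hFun α j x) -
          (∫ x in Set.Ico (0:ℝ) 1, hFun α i x) * (∫ x in Set.Ico (0:ℝ) 1, hFun α j x)
        < C * Real.exp (-b * |(i : ℝ) - (j : ℝ)|) := by
  have hlog : 0 < Real.log 2 := Real.log_pos (by norm_num)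
  have main : ∀ i j : ℕ, i < j →
      (∫ x in Set.Ico (0:ℝ) 1, hFun α i x * hFun α j x) -
          (∫ x in Set.Ico (0:ℝ) 1, hFun α i x) * (∫ x in Set.Ico (0:ℝ) 1, hFun α j x)
        < 11 * Real.exp (-(Real.log 2 / 2) * |(i : ℝ) - (j : ℝ)|) := by
    intro i j hij
    obtain ⟨d, rfl⟩ := Nat.exists_eq_add_of_lt hij
    have h := cov_main α hα hirr i (i + d)
    set r := Real.exp (-(Real.log 2 / 2)) with hr
    have hr0 : 0 < r := Real.exp_pos _
    have hr2 : r ^ 2 = 1 / 2 := by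
      rw [hr, ← Real.exp_nat_mul]
      rw [show ((2:ℕ) : ℝ) * -(Real.log 2 / 2) = -Real.log 2 by push_cast; ring, Real.exp_neg,
        Real.exp_log (by norm_num)]
      norm_num
    have hg := (cfQ_growth α hα hirr r hr0 hr2 i d).2
    have he : Real.exp (-(Real.log 2 / 2) * |(i : ℝ) - ((i + d + 1 : ℕ) : ℝ)|) = r ^ (d + 1) := by
      rw [hr, ← Real.exp_nat_mul]
      congr 1
      rw [abs_of_nonpos (by push_cast; linarith [Nat.cast_nonneg (α := ℝ) d])]
      push_cast; ring
    rw [he]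
    have hq : (0:ℝ) < cfQ α (i + d + 1) := by
      have := (cfQ_pos α hα hirr (i + d)).2
      exact_mod_cast this
    have h2 : (cfQ α i : ℝ) / cfQ α (i + d + 1) ≤ 2 * r ^ (d + 1) := by
      rw [div_le_iff₀ hq]; exact hg
    have : 0 < r ^ (d + 1) := by positivity
    linarith
  refine ⟨11, Real.log 2 / 2, by norm_num, by linarith, ?_⟩
  intro i j _ _ hij
  rcases lt_or_gt_of_ne hij with h | h
  · exact main i j h
  · have := main j i h
    rw [abs_sub_comm, mul_comm (∫ x in Set.Ico (0:ℝ) 1, hFun α i x)]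
    simp_rw [mul_comm (hFun α i _)]
    exact this
end
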